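/- (Proposition 1.) The integral ∫_{ℝ^d} K(x,x) dN(m₀,Σ₀)(x) equals 1 − det(2V − I_d)^{−1/2} · { 1 + 2σ tr[(V + 2σΣ₀)^{−1}Σ₀] + 2σ² (tr[(V + 2σΣ₀)^{−1}Σ₀])² + 4σ² tr[((V + 2σΣ₀)^{−1}Σ₀)²] }. -/

import Mathlib

open MeasureTheory Matrix Real

/-- The Gaussian probability measure `N(m, Σ)` on `ℝ^d`, given by its density
`(2π)^{-d/2} det(Σ)^{-1/2} exp(-(x-m)ᵀ Σ⁻¹ (x-m) / 2)` with respect to Lebesgue measure. -/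
noncomputable def gaussN {d : ℕ} (m : Fin d → ℝ) (S : Matrix (Fin d) (Fin d) ℝ) :
    Measure (Fin d → ℝ) :=
  MeasureTheory.volume.withDensity fun x =>
    ENNReal.ofReal ((2 * π) ^ (-(d : ℝ) / 2) * S.det ^ (-(1 : ℝ) / 2) *
      Real.exp (-((x - m) ⬝ᵥ (S⁻¹ *ᵥ (x - m))) / 2))

/-- `V = I_d + 2σΣ₀`. -/
noncomputable def Vm {d : ℕ} (σ : ℝ) (S : Matrix (Fin d) (Fin d) ℝ) :
    Matrix (Fin d) (Fin d) ℝ :=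
  1 + (2 * σ) • S

/-- `B(x) = (x−m₀)(x−m₀)ᵀ − Σ₀`. -/
noncomputable def Bm {d : ℕ} (m₀ : Fin d → ℝ) (S : Matrix (Fin d) (Fin d) ℝ)
    (x : Fin d → ℝ) : Matrix (Fin d) (Fin d) ℝ :=
  vecMulVec (x - m₀) (x - m₀) - S

/-- `T₁(x,y) = exp(−σ‖x−y‖²)`. -/
noncomputable def T1 {d : ℕ} (σ : ℝ) (x y : Fin d → ℝ) : ℝ :=
  Real.exp (-σ * ((x - y) ⬝ᵥ (x - y)))

/-- `T₂(x,y) = det(V)^{−1/2} exp(−σ(x−m₀)ᵀV⁻¹(x−m₀)) ·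
(1 + 2σ(x−m₀)ᵀV⁻¹(y−m₀) + σ tr[V⁻¹(2σ(B(x)+Σ₀)V⁻¹ − I_d)B(y)])`. -/
noncomputable def T2 {d : ℕ} (σ : ℝ) (m₀ : Fin d → ℝ) (S : Matrix (Fin d) (Fin d) ℝ)
    (x y : Fin d → ℝ) : ℝ :=
  (Vm σ S).det ^ (-(1 : ℝ) / 2) *
    Real.exp (-σ * ((x - m₀) ⬝ᵥ ((Vm σ S)⁻¹ *ᵥ (x - m₀)))) *
    (1 + 2 * σ * ((x - m₀) ⬝ᵥ ((Vm σ S)⁻¹ *ᵥ (y - m₀))) +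
      σ * ((Vm σ S)⁻¹ * ((2 * σ) • (Bm m₀ S x + S) * (Vm σ S)⁻¹ - 1) * Bm m₀ S y).trace)

/-- `T₃(x,y) = T₂(y,x)`. -/
noncomputable def T3 {d : ℕ} (σ : ℝ) (m₀ : Fin d → ℝ) (S : Matrix (Fin d) (Fin d) ℝ)
    (x y : Fin d → ℝ) : ℝ :=
  T2 σ m₀ S y x

/-- `T₄(x,y) = det(2V−I_d)^{−1/2} · (1 + σ tr[(2(x−m₀)(y−m₀)ᵀ − B(x) − B(y))(2V−I_d)⁻¹]
+ σ²(tr[B(x)(2V−I_d)⁻¹]·tr[B(y)(2V−I_d)⁻¹] + 2 tr[B(x)(2V−I_d)⁻¹B(y)(2V−I_d)⁻¹]))`. -/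
noncomputable def T4 {d : ℕ} (σ : ℝ) (m₀ : Fin d → ℝ) (S : Matrix (Fin d) (Fin d) ℝ)
    (x y : Fin d → ℝ) : ℝ :=
  ((2 : ℝ) • Vm σ S - 1).det ^ (-(1 : ℝ) / 2) *
    (1 + σ * (((2 : ℝ) • vecMulVec (x - m₀) (y - m₀) - Bm m₀ S x - Bm m₀ S y) *
        ((2 : ℝ) • Vm σ S - 1)⁻¹).trace +
      σ ^ 2 * ((Bm m₀ S x * ((2 : ℝ) • Vm σ S - 1)⁻¹).trace *
          (Bm m₀ S y * ((2 : ℝ) • Vm σ S - 1)⁻¹).trace +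
        2 * (Bm m₀ S x * ((2 : ℝ) • Vm σ S - 1)⁻¹ *
          Bm m₀ S y * ((2 : ℝ) • Vm σ S - 1)⁻¹).trace))

/-- `K(x,y) = T₁(x,y) − T₂(x,y) − T₃(x,y) + T₄(x,y)`. -/
noncomputable def Kf {d : ℕ} (σ : ℝ) (m₀ : Fin d → ℝ) (S : Matrix (Fin d) (Fin d) ℝ)
    (x y : Fin d → ℝ) : ℝ :=
  T1 σ x y - T2 σ m₀ S x y - T3 σ m₀ S x y + T4 σ m₀ S x y

open ProbabilityTheory

lemma integral_pow_four_gaussianReal : ∫ x, x ^ 4 ∂gaussianReal 0 1 = 3 := by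
  have h : ∫ x, x ^ 4 ∂gaussianReal 0 1 = iteratedDeriv 4 (mgf (fun x ↦ x) (gaussianReal 0 1)) 0 := by
    rw [iteratedDeriv_mgf_zero] <;> simp
  have step (p p' : ℝ → ℝ) (hp : ∀ t, HasDerivAt p (p' t) t) :
      deriv (fun t ↦ p t * Real.exp (t ^ 2 / 2)) = fun t ↦ (p' t + p t * t) * Real.exp (t ^ 2 / 2) := by
    ext t
    have h2 : HasDerivAt (fun t : ℝ ↦ t ^ 2 / 2) t t := by
      simpa using (hasDerivAt_pow 2 t).div_const 2
    exact ((hp t).mul h2.exp).deriv.trans (by ring)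
  have h0 : mgf (fun x ↦ x) (gaussianReal 0 1) = fun t ↦ 1 * Real.exp (t ^ 2 / 2) := by
    rw [mgf_fun_id_gaussianReal]
    simp
  rw [h, h0, iteratedDeriv_eq_iterate]
  simp only [Function.iterate_succ, Function.iterate_zero, Function.comp_apply, id]
  rw [step (fun _ ↦ 1) (fun _ ↦ 0) (fun t ↦ hasDerivAt_const t 1),
    step _ (fun _ ↦ 1) fun t ↦ by simpa using hasDerivAt_id' t,
    step _ (fun t ↦ 2 * t) fun t ↦ by
      simpa [← sq] using (hasDerivAt_pow 2 t).const_add 1,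
    step _ (fun t ↦ 3 + 3 * t ^ 2) fun t ↦ by
      convert! ((hasDerivAt_id' t).const_mul 3).add (hasDerivAt_pow 3 t) using 1
      · ext s
        simp
        ring
      · simp]
  simp

lemma integral_pow_two_gaussianReal : ∫ x, x ^ 2 ∂gaussianReal 0 1 = 1 := by
  have h := variance_eq_integral (μ := gaussianReal 0 1) (X := fun x ↦ x) (by fun_prop)
  simpa using h.symm

lemma integrable_pow_gaussianReal (n : ℕ) : Integrable (fun x : ℝ ↦ x ^ n) (gaussianReal 0 1) := by
  have := (memLp_id_gaussianReal (μ := 0) (v := 1) n).integrable_norm_pow'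
  exact (integrable_norm_iff (by fun_prop)).1 (by simpa using this)

section StandardGaussian

variable {ι : Type*} [Fintype ι]

lemma prod_pow_ite_add_ite [DecidableEq ι] (i j : ι) (x : ι → ℝ) :
    ∏ k, x k ^ ((if k = i then 2 else 0) + (if k = j then 2 else 0)) = x i ^ 2 * x j ^ 2 := by
  simp_rw [pow_add, Finset.prod_mul_distrib, pow_ite]
  simp

lemma integrable_sq_mul_sq_pi_gaussianReal (i j : ι) :
    Integrable (fun x : ι → ℝ ↦ x i ^ 2 * x j ^ 2) (Measure.pi fun _ ↦ gaussianReal 0 1) := by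
  classical
  simp_rw [← prod_pow_ite_add_ite i j]
  exact Integrable.fintype_prod (f := fun k (t : ℝ) ↦
    t ^ ((if k = i then 2 else 0) + (if k = j then 2 else 0)))
    fun k ↦ integrable_pow_gaussianReal _

lemma integral_sq_mul_sq_pi_gaussianReal [DecidableEq ι] (i j : ι) :
    ∫ x : ι → ℝ, x i ^ 2 * x j ^ 2 ∂(Measure.pi fun _ ↦ gaussianReal 0 1) =
      1 + if i = j then 2 else 0 := by
  simp_rw [← prod_pow_ite_add_ite i j]
  rw [integral_fintype_prod_eq_prod (fun k (t : ℝ) ↦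
    t ^ ((if k = i then 2 else 0) + (if k = j then 2 else 0)))]
  have h (k : ι) : ∫ t : ℝ, t ^ ((if k = i then 2 else 0) + (if k = j then 2 else 0))
      ∂(gaussianReal 0 1) = if k = i then (1 + if i = j then 2 else 0) else 1 := by
    by_cases hi : k = i <;> by_cases hj : k = j
    · subst hi hj
      simp [integral_pow_four_gaussianReal]
      norm_num
    · subst hi
      simp [hj, integral_pow_two_gaussianReal]
    · subst hj
      simp [hi, integral_pow_two_gaussianReal]
    · simp [hi, hj]
  simp [h]

lemma integrable_sq_pi_gaussianReal (i : ι) :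
    Integrable (fun x : ι → ℝ ↦ x i ^ 2) (Measure.pi fun _ ↦ gaussianReal 0 1) :=
  (measurePreserving_eval (fun _ : ι ↦ gaussianReal 0 1) i).integrable_comp_of_integrable
    (integrable_pow_gaussianReal 2)

lemma integral_sq_pi_gaussianReal (i : ι) :
    ∫ x : ι → ℝ, x i ^ 2 ∂(Measure.pi fun _ ↦ gaussianReal 0 1) = 1 := by
  have h := measurePreserving_eval (fun _ : ι ↦ gaussianReal 0 1) i
  have h2 := integral_map (μ := Measure.pi fun _ : ι ↦ gaussianReal 0 1) h.measurable.aemeasurable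
    (f := fun t : ℝ ↦ t ^ 2) (by fun_prop)
  rw [h.map_eq, integral_pow_two_gaussianReal] at h2
  exact h2.symm

lemma integrable_sum_mul_sq_pi_gaussianReal (c : ι → ℝ) :
    Integrable (fun x : ι → ℝ ↦ ∑ i, c i * x i ^ 2) (Measure.pi fun _ ↦ gaussianReal 0 1) :=
  integrable_finsetSum _ fun i _ ↦ (integrable_sq_pi_gaussianReal i).const_mul _

lemma integral_sum_mul_sq_pi_gaussianReal (c : ι → ℝ) :
    ∫ x : ι → ℝ, ∑ i, c i * x i ^ 2 ∂(Measure.pi fun _ ↦ gaussianReal 0 1) = ∑ i, c i := by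
  rw [integral_finsetSum _ fun i _ ↦ (integrable_sq_pi_gaussianReal i).const_mul _]
  simp [integral_const_mul, integral_sq_pi_gaussianReal]

lemma sq_sum_mul_sq (c x : ι → ℝ) :
    (∑ i, c i * x i ^ 2) ^ 2 = ∑ i, ∑ j, c i * c j * (x i ^ 2 * x j ^ 2) := by
  rw [sq, Finset.sum_mul_sum]
  exact Finset.sum_congr rfl fun i _ ↦ Finset.sum_congr rfl fun j _ ↦ by ring

lemma integrable_sq_sum_mul_sq_pi_gaussianReal (c : ι → ℝ) :
    Integrable (fun x : ι → ℝ ↦ (∑ i, c i * x i ^ 2) ^ 2)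
      (Measure.pi fun _ ↦ gaussianReal 0 1) := by
  simp_rw [sq_sum_mul_sq]
  exact integrable_finsetSum _ fun i _ ↦ integrable_finsetSum _ fun j _ ↦
    (integrable_sq_mul_sq_pi_gaussianReal i j).const_mul _

lemma integral_sq_sum_mul_sq_pi_gaussianReal (c : ι → ℝ) :
    ∫ x : ι → ℝ, (∑ i, c i * x i ^ 2) ^ 2 ∂(Measure.pi fun _ ↦ gaussianReal 0 1) =
      (∑ i, c i) ^ 2 + 2 * ∑ i, c i ^ 2 := by
  classical
  simp_rw [sq_sum_mul_sq]
  rw [integral_finsetSum _ fun i _ ↦ integrable_finsetSum _ fun j _ ↦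
    (integrable_sq_mul_sq_pi_gaussianReal i j).const_mul _]
  simp_rw [integral_finsetSum _ fun j _ ↦
    (integrable_sq_mul_sq_pi_gaussianReal _ j).const_mul _, integral_const_mul,
    integral_sq_mul_sq_pi_gaussianReal, mul_add, mul_one, Finset.sum_add_distrib]
  rw [sq (∑ i, c i), Finset.sum_mul_sum, Finset.mul_sum]
  congr 1
  refine Finset.sum_congr rfl fun i _ ↦ ?_
  simp
  ring

lemma pi_gaussianReal_eq_withDensity :
    (Measure.pi fun _ : ι ↦ gaussianReal 0 1) =
      volume.withDensity fun x ↦ ENNReal.ofReal (∏ i, gaussianPDFReal 0 1 (x i)) := by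
  refine Measure.pi_eq fun s hs ↦ ?_
  rw [withDensity_apply _ (.univ_pi hs), volume_pi, Measure.restrict_pi_pi,
    ← ofReal_integral_eq_lintegral_ofReal, integral_fintype_prod_eq_prod,
    ENNReal.ofReal_prod_of_nonneg]
  · refine Finset.prod_congr rfl fun i _ ↦ ?_
    rw [gaussianReal_apply_eq_integral _ one_ne_zero]
  · exact fun i _ ↦ integral_nonneg fun x ↦ gaussianPDFReal_nonneg 0 1 x
  · exact Integrable.fintype_prod fun i ↦ (integrable_gaussianPDFReal 0 1).restrict
  · exact .of_forall fun x ↦ Finset.prod_nonneg fun i _ ↦ gaussianPDFReal_nonneg 0 1 _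

end StandardGaussian

lemma prod_gaussianPDFReal {d : ℕ} (x : Fin d → ℝ) :
    ∏ i, gaussianPDFReal 0 1 (x i) = (2 * π) ^ (-(d : ℝ) / 2) * Real.exp (-(x ⬝ᵥ x) / 2) := by
  simp only [gaussianPDFReal, NNReal.coe_one, mul_one, sub_zero, Finset.prod_mul_distrib,
    Finset.prod_const, Finset.card_univ, Fintype.card_fin, ← Real.exp_sum]
  congr 1
  · rw [Real.sqrt_eq_rpow, ← Real.rpow_neg (by positivity), ← Real.rpow_natCast,
      ← Real.rpow_mul (by positivity)]
    congr 1
    ring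
  · rw [← Finset.sum_div, Finset.sum_neg_distrib]
    simp [dotProduct, sq]

lemma volume_eq_smul_map_add_mulVec {d : ℕ} (m : Fin d → ℝ) {A : Matrix (Fin d) (Fin d) ℝ}
    (hA : A.det ≠ 0) :
    (volume : Measure (Fin d → ℝ)) =
      ENNReal.ofReal |A.det| • volume.map fun z ↦ m + A *ᵥ z := by
  have h : (fun z ↦ m + A *ᵥ z) = (fun z ↦ m + z) ∘ toLin' A := by
    ext; simp
  have hmeas : Measurable (toLin' A) := (LinearMap.continuous_of_finiteDimensional _).measurable
  rw [h, ← Measure.map_map (measurable_const_add m) hmeas,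
    Real.map_matrix_volume_pi_eq_smul_volume_pi hA, Measure.map_smul, map_add_left_eq_self,
    smul_smul, ← ENNReal.ofReal_mul (abs_nonneg _), ← abs_mul, mul_inv_cancel₀ hA]
  simp

lemma gaussN_eq_map {d : ℕ} (m : Fin d → ℝ) {A : Matrix (Fin d) (Fin d) ℝ} (hA : A.det ≠ 0) :
    gaussN m (A * Aᵀ) =
      (Measure.pi fun _ ↦ gaussianReal 0 1).map fun z ↦ m + A *ᵥ z := by
  have hmeas : Measurable fun z ↦ m + A *ᵥ z := by
    have : Continuous fun z ↦ m + A *ᵥ z := by fun_prop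
    exact this.measurable
  ext s hs
  rw [Measure.map_apply hmeas hs, pi_gaussianReal_eq_withDensity, gaussN, withDensity_apply _ hs,
    withDensity_apply _ (hmeas hs)]
  nth_rw 1 [volume_eq_smul_map_add_mulVec m hA]
  rw [Measure.restrict_smul, lintegral_smul_measure, setLIntegral_map hs ?_ hmeas, smul_eq_mul,
    ← lintegral_const_mul]
  · refine lintegral_congr fun z ↦ ?_
    rw [← ENNReal.ofReal_mul (abs_nonneg _), prod_gaussianPDFReal, add_sub_cancel_left]
    have hQ : (A *ᵥ z) ⬝ᵥ ((A * Aᵀ)⁻¹ *ᵥ (A *ᵥ z)) = z ⬝ᵥ z := by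
      have hu : IsUnit A.det := hA.isUnit
      rw [mulVec_mulVec, dotProduct_mulVec, vecMul_mulVec, ← dotProduct_mulVec,
        Matrix.mul_inv_rev, mul_assoc, nonsing_inv_mul _ hu, mul_one, ← transpose_nonsing_inv,
        ← transpose_mul, nonsing_inv_mul _ hu]
      simp
    have hdet : |A.det| * (A * Aᵀ).det ^ (-(1 : ℝ) / 2) = 1 := by
      rw [det_mul, det_transpose, ← sq, ← sq_abs, ← Real.rpow_natCast,
        ← Real.rpow_mul (abs_nonneg _)]
      have : ((2 : ℕ) : ℝ) * (-1 / 2) = -1 := by norm_num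
      rw [this, Real.rpow_neg_one, mul_inv_cancel₀ (abs_ne_zero.2 hA)]
    rw [hQ]
    congr 1
    linear_combination ((2 * π) ^ (-(d : ℝ) / 2) * Real.exp (-(z ⬝ᵥ z) / 2)) * hdet
  · fun_prop
  · fun_prop

lemma exists_mul_transpose_eq_and_diagonal {d : ℕ} {S M : Matrix (Fin d) (Fin d) ℝ}
    (hS : S.PosDef) (hM : Mᵀ = M) :
    ∃ (A : Matrix (Fin d) (Fin d) ℝ) (n : Fin d → ℝ), A * Aᵀ = S ∧ Aᵀ * M * A = diagonal n := by
  open scoped MatrixOrder in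
  obtain ⟨B, hB⟩ := CStarAlgebra.nonneg_iff_eq_mul_star_self.mp hS.posSemidef.nonneg
  have hN : (Bᵀ * M * B).IsHermitian := by
    simp [IsHermitian, conjTranspose_eq_transpose_of_trivial, hM, mul_assoc]
  set U : Matrix (Fin d) (Fin d) ℝ := hN.eigenvectorUnitary.1
  have hU : U * star U = 1 := Unitary.coe_mul_star_self hN.eigenvectorUnitary
  have hU' : star U * U = 1 := Unitary.coe_star_mul_self hN.eigenvectorUnitary
  have hspec := hN.spectral_theorem
  rw [Unitary.conjStarAlgAut_apply] at hspec
  change _ = U * _ * star U at hspec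
  rw [star_eq_conjTranspose, conjTranspose_eq_transpose_of_trivial] at hU hU' hspec hB
  refine ⟨B * U, RCLike.ofReal ∘ hN.eigenvalues, ?_, ?_⟩
  · rw [transpose_mul, mul_assoc, ← mul_assoc U, hU, one_mul, hB]
  · calc (B * U)ᵀ * M * (B * U) = Uᵀ * (Bᵀ * M * B) * U := by
          simp only [transpose_mul, mul_assoc]
      _ = (Uᵀ * U) * diagonal (RCLike.ofReal ∘ hN.eigenvalues) * (Uᵀ * U) := by
          refine (congrArg (Uᵀ * · * U) hspec).trans ?_
          simp only [mul_assoc]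
      _ = _ := by rw [hU', one_mul, mul_one]

section Moments

variable {d : ℕ} (m : Fin d → ℝ) {S M : Matrix (Fin d) (Fin d) ℝ}

lemma exists_gaussN_eq_map_and_quadratic (hS : S.PosDef) (hM : Mᵀ = M) :
    ∃ (φ : (Fin d → ℝ) → Fin d → ℝ) (n : Fin d → ℝ), Measurable φ ∧
      gaussN m S = (Measure.pi fun _ ↦ gaussianReal 0 1).map φ ∧
      (∀ z, (φ z - m) ⬝ᵥ (M *ᵥ (φ z - m)) = ∑ i, n i * z i ^ 2) ∧
      (M * S).trace = ∑ i, n i ∧ (M * S * (M * S)).trace = ∑ i, n i ^ 2 := by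
  obtain ⟨A, n, rfl, hn⟩ := exists_mul_transpose_eq_and_diagonal hS hM
  have hA : A.det ≠ 0 := fun h ↦ hS.det_pos.ne' (by simp [h])
  have hc : Continuous fun z ↦ m + A *ᵥ z := by fun_prop
  refine ⟨_, n, hc.measurable, gaussN_eq_map m hA, fun z ↦ ?_, ?_, ?_⟩
  · rw [add_sub_cancel_left, mulVec_mulVec, dotProduct_mulVec, vecMul_mulVec, ← dotProduct_mulVec,
      ← mul_assoc, hn]
    simp only [dotProduct, mulVec_diagonal]
    exact Finset.sum_congr rfl fun i _ ↦ by ring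
  · rw [← mul_assoc, trace_mul_comm, ← mul_assoc, hn, trace_diagonal]
  · calc (M * (A * Aᵀ) * (M * (A * Aᵀ))).trace = (M * A * (Aᵀ * M * A) * Aᵀ).trace := by
          simp only [mul_assoc]
      _ = (Aᵀ * M * A * (Aᵀ * M * A)).trace := by
          rw [trace_mul_comm]
          simp only [mul_assoc]
      _ = _ := by
          rw [hn, diagonal_mul_diagonal, trace_diagonal]
          exact Finset.sum_congr rfl fun i _ ↦ (sq _).symm

lemma isProbabilityMeasure_gaussN (hS : S.PosDef) : IsProbabilityMeasure (gaussN m S) := by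
  obtain ⟨φ, n, hφ, h, -⟩ := exists_gaussN_eq_map_and_quadratic m hS (transpose_one)
  rw [h]
  exact Measure.isProbabilityMeasure_map hφ.aemeasurable

lemma continuous_quadratic (M : Matrix (Fin d) (Fin d) ℝ) :
    Continuous fun x ↦ (x - m) ⬝ᵥ (M *ᵥ (x - m)) := by
  fun_prop

lemma integrable_quadratic_gaussN (hS : S.PosDef) (hM : Mᵀ = M) :
    Integrable (fun x ↦ (x - m) ⬝ᵥ (M *ᵥ (x - m))) (gaussN m S) := by
  obtain ⟨φ, n, hφ, h, hq, -⟩ := exists_gaussN_eq_map_and_quadratic m hS hM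
  rw [h, integrable_map_measure (continuous_quadratic m M).aestronglyMeasurable hφ.aemeasurable]
  simpa only [Function.comp_def, hq] using integrable_sum_mul_sq_pi_gaussianReal n

lemma integral_quadratic_gaussN (hS : S.PosDef) (hM : Mᵀ = M) :
    ∫ x, (x - m) ⬝ᵥ (M *ᵥ (x - m)) ∂gaussN m S = (M * S).trace := by
  obtain ⟨φ, n, hφ, h, hq, ht, -⟩ := exists_gaussN_eq_map_and_quadratic m hS hM
  rw [h, integral_map hφ.aemeasurable (continuous_quadratic m M).aestronglyMeasurable, ht]
  simpa only [hq] using integral_sum_mul_sq_pi_gaussianReal n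

lemma integrable_sq_quadratic_gaussN (hS : S.PosDef) (hM : Mᵀ = M) :
    Integrable (fun x ↦ ((x - m) ⬝ᵥ (M *ᵥ (x - m))) ^ 2) (gaussN m S) := by
  obtain ⟨φ, n, hφ, h, hq, -⟩ := exists_gaussN_eq_map_and_quadratic m hS hM
  rw [h, integrable_map_measure ((continuous_quadratic m M).fun_pow 2).aestronglyMeasurable
    hφ.aemeasurable]
  simpa only [Function.comp_def, hq] using integrable_sq_sum_mul_sq_pi_gaussianReal n

lemma integral_sq_quadratic_gaussN (hS : S.PosDef) (hM : Mᵀ = M) :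
    ∫ x, ((x - m) ⬝ᵥ (M *ᵥ (x - m))) ^ 2 ∂gaussN m S =
      (M * S).trace ^ 2 + 2 * (M * S * (M * S)).trace := by
  obtain ⟨φ, n, hφ, h, hq, ht, ht2⟩ := exists_gaussN_eq_map_and_quadratic m hS hM
  rw [h, integral_map hφ.aemeasurable ((continuous_quadratic m M).fun_pow 2).aestronglyMeasurable,
    ht, ht2]
  simpa only [hq] using integral_sq_sum_mul_sq_pi_gaussianReal n

end Moments

section Tilting

variable {d : ℕ} (m : Fin d → ℝ) {S S' P : Matrix (Fin d) (Fin d) ℝ}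

lemma gaussN_withDensity_exp_quadratic (hS' : 0 < S'.det) (hP : S'⁻¹ = S⁻¹ + P) :
    (gaussN m S).withDensity
        (fun x ↦ ENNReal.ofReal (Real.exp (-((x - m) ⬝ᵥ (P *ᵥ (x - m))) / 2))) =
      ENNReal.ofReal (S.det ^ (-(1 : ℝ) / 2) * S'.det ^ ((1 : ℝ) / 2)) • gaussN m S' := by
  have hm (M : Matrix (Fin d) (Fin d) ℝ) :
      Measurable fun x ↦ (x - m) ⬝ᵥ (M *ᵥ (x - m)) := (continuous_quadratic m M).measurable
  have h1 := hm P
  have h2 := hm S⁻¹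
  have h3 := hm S'⁻¹
  rw [gaussN, gaussN, ← withDensity_mul _ (by fun_prop) (by fun_prop),
    ← withDensity_smul _ (by fun_prop)]
  congr 1
  ext x
  rw [Pi.mul_apply, Pi.smul_apply, smul_eq_mul, ← ENNReal.ofReal_mul' (Real.exp_nonneg _),
    ← ENNReal.ofReal_mul' (by positivity), hP, add_mulVec, dotProduct_add, neg_add, add_div,
    Real.exp_add]
  have hdet : S'.det ^ ((1 : ℝ) / 2) * S'.det ^ (-(1 : ℝ) / 2) = 1 := by
    rw [← Real.rpow_add hS']
    norm_num
  congr 1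
  linear_combination (-(2 * π) ^ (-(d : ℝ) / 2) * S.det ^ (-(1 : ℝ) / 2) *
    Real.exp (-((x - m) ⬝ᵥ (S⁻¹ *ᵥ (x - m))) / 2) *
    Real.exp (-((x - m) ⬝ᵥ (P *ᵥ (x - m))) / 2)) * hdet

lemma measurable_ofReal_exp_quadratic (P : Matrix (Fin d) (Fin d) ℝ) :
    Measurable fun x ↦ ENNReal.ofReal (Real.exp (-((x - m) ⬝ᵥ (P *ᵥ (x - m))) / 2)) := by
  have := (continuous_quadratic m P).measurable
  fun_prop

lemma integrable_exp_quadratic_mul (hS' : 0 < S'.det) (hP : S'⁻¹ = S⁻¹ + P)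
    {f : (Fin d → ℝ) → ℝ} (hf : Integrable f (gaussN m S')) :
    Integrable (fun x ↦ Real.exp (-((x - m) ⬝ᵥ (P *ᵥ (x - m))) / 2) * f x) (gaussN m S) := by
  have h := hf.smul_measure (c := ENNReal.ofReal (S.det ^ (-(1 : ℝ) / 2) * S'.det ^ ((1 : ℝ) / 2)))
    ENNReal.ofReal_ne_top
  rw [← gaussN_withDensity_exp_quadratic m hS' hP, integrable_withDensity_iff_integrable_smul'
    (measurable_ofReal_exp_quadratic m P) (.of_forall fun _ ↦ ENNReal.ofReal_lt_top)] at h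
  simpa only [ENNReal.toReal_ofReal (Real.exp_nonneg _), smul_eq_mul] using h

lemma integral_exp_quadratic_mul (hS : 0 < S.det) (hS' : 0 < S'.det) (hP : S'⁻¹ = S⁻¹ + P)
    (f : (Fin d → ℝ) → ℝ) :
    ∫ x, Real.exp (-((x - m) ⬝ᵥ (P *ᵥ (x - m))) / 2) * f x ∂gaussN m S =
      S.det ^ (-(1 : ℝ) / 2) * S'.det ^ ((1 : ℝ) / 2) * ∫ x, f x ∂gaussN m S' := by
  have h := integral_smul_measure (μ := gaussN m S') f
    (ENNReal.ofReal (S.det ^ (-(1 : ℝ) / 2) * S'.det ^ ((1 : ℝ) / 2)))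
  rw [← gaussN_withDensity_exp_quadratic m hS' hP, integral_withDensity_eq_integral_toReal_smul
    (measurable_ofReal_exp_quadratic m P) (.of_forall fun _ ↦ ENNReal.ofReal_lt_top),
    ENNReal.toReal_ofReal (by positivity)] at h
  simpa only [ENNReal.toReal_ofReal (Real.exp_nonneg _), smul_eq_mul] using h

end Tilting

section Diagonal

variable {d : ℕ} (σ : ℝ) (m₀ : Fin d → ℝ) (S : Matrix (Fin d) (Fin d) ℝ)

lemma trace_vecMulVec_self_mul (y : Fin d → ℝ) (M : Matrix (Fin d) (Fin d) ℝ) :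
    (vecMulVec y y * M).trace = y ⬝ᵥ (M *ᵥ y) := by
  rw [vecMulVec_mul, trace_vecMulVec, dotProduct_comm, dotProduct_mulVec]

lemma trace_vecMulVec_self_mul_mul (y : Fin d → ℝ) (M : Matrix (Fin d) (Fin d) ℝ) :
    (vecMulVec y y * M * vecMulVec y y * M).trace = (y ⬝ᵥ (M *ᵥ y)) ^ 2 := by
  rw [mul_assoc, vecMulVec_mul, vecMulVec_mul_vecMulVec, trace_vecMulVec,
    dotProduct_smul, dotProduct_comm y, ← dotProduct_mulVec, smul_eq_mul, sq]

lemma T1_self (x : Fin d → ℝ) : T1 σ x x = 1 := by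
  simp [T1]

lemma T2_self (x : Fin d → ℝ) :
    T2 σ m₀ S x x = (Vm σ S).det ^ (-(1 : ℝ) / 2) *
      (Real.exp (-((x - m₀) ⬝ᵥ (((2 * σ) • (Vm σ S)⁻¹) *ᵥ (x - m₀))) / 2) *
        (1 + σ * ((Vm σ S)⁻¹ * S).trace + σ * ((x - m₀) ⬝ᵥ ((Vm σ S)⁻¹ *ᵥ (x - m₀))) +
          2 * σ ^ 2 * ((x - m₀) ⬝ᵥ ((Vm σ S)⁻¹ *ᵥ (x - m₀))) ^ 2 -
          2 * σ ^ 2 * ((x - m₀) ⬝ᵥ (((Vm σ S)⁻¹ * S * (Vm σ S)⁻¹) *ᵥ (x - m₀))))) := by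
  rw [T2, Bm]
  set y := x - m₀
  set N := (Vm σ S)⁻¹
  have htr : (N * ((2 * σ) • (vecMulVec y y - S + S) * N - 1) * (vecMulVec y y - S)).trace =
      2 * σ * (y ⬝ᵥ (N *ᵥ y)) ^ 2 - y ⬝ᵥ (N *ᵥ y) - 2 * σ * (y ⬝ᵥ ((N * S * N) *ᵥ y)) +
        (N * S).trace := by
    have h1 : (N * (vecMulVec y y * (N * vecMulVec y y))).trace = (y ⬝ᵥ (N *ᵥ y)) ^ 2 := by
      rw [trace_mul_comm, ← trace_vecMulVec_self_mul_mul]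
      simp only [mul_assoc]
    have h2 : (N * (vecMulVec y y * (N * S))).trace = y ⬝ᵥ ((N * S * N) *ᵥ y) := by
      rw [trace_mul_comm, ← trace_vecMulVec_self_mul]
      simp only [mul_assoc]
    have h3 : (N * vecMulVec y y).trace = y ⬝ᵥ (N *ᵥ y) := by
      rw [trace_mul_comm, trace_vecMulVec_self_mul]
    simp only [sub_add_cancel, mul_sub, sub_mul, mul_one, smul_mul_assoc, mul_smul_comm,
      trace_sub, trace_smul, mul_assoc, smul_eq_mul] at h1 h2 h3 ⊢
    rw [h1, h2, h3]
    ring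
  have hexp : -((y) ⬝ᵥ (((2 * σ) • N) *ᵥ y)) / 2 = -σ * (y ⬝ᵥ (N *ᵥ y)) := by
    rw [smul_mulVec, dotProduct_smul, smul_eq_mul]
    ring
  rw [htr, hexp]
  ring

lemma T4_self (x : Fin d → ℝ) :
    T4 σ m₀ S x x = ((2 : ℝ) • Vm σ S - 1).det ^ (-(1 : ℝ) / 2) *
      (1 + 2 * σ * (((2 : ℝ) • Vm σ S - 1)⁻¹ * S).trace +
        σ ^ 2 * (((2 : ℝ) • Vm σ S - 1)⁻¹ * S).trace ^ 2 +
        2 * σ ^ 2 * ((((2 : ℝ) • Vm σ S - 1)⁻¹ * S) ^ 2).trace +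
        -(2 * σ ^ 2 * (((2 : ℝ) • Vm σ S - 1)⁻¹ * S).trace) *
          ((x - m₀) ⬝ᵥ (((2 : ℝ) • Vm σ S - 1)⁻¹ *ᵥ (x - m₀))) +
        3 * σ ^ 2 * ((x - m₀) ⬝ᵥ (((2 : ℝ) • Vm σ S - 1)⁻¹ *ᵥ (x - m₀))) ^ 2 -
        4 * σ ^ 2 * ((x - m₀) ⬝ᵥ ((((2 : ℝ) • Vm σ S - 1)⁻¹ * S *
          ((2 : ℝ) • Vm σ S - 1)⁻¹) *ᵥ (x - m₀)))) := by
  rw [T4, Bm]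
  set y := x - m₀
  set N := ((2 : ℝ) • Vm σ S - 1)⁻¹
  have h0 : ((2 : ℝ) • vecMulVec y y - (vecMulVec y y - S) - (vecMulVec y y - S)) * N =
      (2 : ℝ) • (S * N) := by
    rw [two_smul, two_smul, ← add_mul]
    congr 1
    abel
  have hN : (S * N).trace = (N * S).trace := trace_mul_comm _ _
  have htr : ((vecMulVec y y - S) * N).trace = y ⬝ᵥ (N *ᵥ y) - (N * S).trace := by
    rw [sub_mul, trace_sub, trace_vecMulVec_self_mul, hN]
  have htr2 : ((vecMulVec y y - S) * N * (vecMulVec y y - S) * N).trace =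
      (y ⬝ᵥ (N *ᵥ y)) ^ 2 - 2 * (y ⬝ᵥ ((N * S * N) *ᵥ y)) + ((N * S) ^ 2).trace := by
    have h1 : (vecMulVec y y * N * S * N).trace = y ⬝ᵥ ((N * S * N) *ᵥ y) := by
      rw [← trace_vecMulVec_self_mul]
      simp only [mul_assoc]
    have h2 : (S * N * vecMulVec y y * N).trace = y ⬝ᵥ ((N * S * N) *ᵥ y) := by
      rw [mul_assoc, trace_mul_comm, ← h1]
      simp only [mul_assoc]
    have h3 : (S * N * S * N).trace = ((N * S) ^ 2).trace := by
      rw [trace_mul_comm, sq]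
      simp only [mul_assoc]
    simp only [sub_mul, mul_sub, trace_sub]
    rw [trace_vecMulVec_self_mul_mul, h1, h2, h3]
    ring
  rw [h0, trace_smul, smul_eq_mul, hN, htr, htr2]
  ring

end Diagonal

section Integrals

variable {d : ℕ} {σ : ℝ} (m₀ : Fin d → ℝ) {S : Matrix (Fin d) (Fin d) ℝ}

lemma posDef_one_add_smul {c : ℝ} (hc : 0 < c) (hS : S.PosDef) :
    (1 + c • S : Matrix (Fin d) (Fin d) ℝ).PosDef :=
  PosDef.one.add (hS.smul hc)

lemma transpose_inv_eq_of_posDef (hS : S.PosDef) : (S⁻¹)ᵀ = S⁻¹ := by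
  simpa [IsHermitian, conjTranspose_eq_transpose_of_trivial] using hS.inv.isHermitian

lemma transpose_inv_mul_mul_inv {M : Matrix (Fin d) (Fin d) ℝ} (hS : S.PosDef) (hM : M.PosDef) :
    (M⁻¹ * S * M⁻¹)ᵀ = M⁻¹ * S * M⁻¹ := by
  have h : Sᵀ = S := by
    simpa [IsHermitian, conjTranspose_eq_transpose_of_trivial] using hS.isHermitian
  rw [transpose_mul, transpose_mul, transpose_inv_eq_of_posDef hM, h, mul_assoc]

lemma two_smul_Vm_sub_one (σ : ℝ) (S : Matrix (Fin d) (Fin d) ℝ) :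
    (2 : ℝ) • Vm σ S - 1 = Vm σ S + (2 * σ) • S := by
  rw [Vm, two_smul]
  abel

lemma posDef_Vm (hσ : 0 < σ) (hS : S.PosDef) : (Vm σ S).PosDef :=
  posDef_one_add_smul (by positivity) hS

lemma posDef_Vm_add (hσ : 0 < σ) (hS : S.PosDef) : (Vm σ S + (2 * σ) • S).PosDef :=
  (posDef_Vm hσ hS).add (hS.smul (by positivity))

lemma inv_Vm_mul_sub (hσ : 0 < σ) (hS : S.PosDef) :
    (Vm σ S)⁻¹ * S - (Vm σ S + (2 * σ) • S)⁻¹ * S =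
      (2 * σ) • ((Vm σ S)⁻¹ * S * ((Vm σ S + (2 * σ) • S)⁻¹ * S)) := by
  have hV := (posDef_Vm hσ hS).det_pos.ne'.isUnit
  have hW := (posDef_Vm_add hσ hS).det_pos.ne'.isUnit
  set V := Vm σ S
  set W := V + (2 * σ) • S with hWV
  calc V⁻¹ * S - W⁻¹ * S = V⁻¹ * (W * W⁻¹) * S - (V⁻¹ * V) * W⁻¹ * S := by
        rw [mul_nonsing_inv _ hW, nonsing_inv_mul _ hV, mul_one, one_mul]
    _ = V⁻¹ * (W - V) * W⁻¹ * S := by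
        simp only [mul_sub, sub_mul, mul_assoc]
    _ = _ := by
        rw [hWV, add_sub_cancel_left]
        simp only [mul_assoc, smul_mul_assoc, mul_smul_comm]

lemma inv_tilted_covariance (hσ : 0 < σ) (hS : S.PosDef) :
    (Vm σ S * (Vm σ S + (2 * σ) • S)⁻¹ * S)⁻¹ = S⁻¹ + (2 * σ) • (Vm σ S)⁻¹ := by
  have hS' := hS.det_pos.ne'.isUnit
  have hV := (posDef_Vm hσ hS).det_pos.ne'.isUnit
  have hW := (posDef_Vm_add hσ hS).det_pos.ne'.isUnit
  refine inv_eq_left_inv ?_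
  have h : (S⁻¹ + (2 * σ) • (Vm σ S)⁻¹) * Vm σ S = S⁻¹ * (Vm σ S + (2 * σ) • S) := by
    rw [add_mul, mul_add, smul_mul_assoc, mul_smul_comm, nonsing_inv_mul _ hV,
      nonsing_inv_mul _ hS']
  rw [← mul_assoc, ← mul_assoc, h, mul_assoc S⁻¹, mul_nonsing_inv _ hW, mul_one,
    nonsing_inv_mul _ hS']

lemma posDef_tilted_covariance (hσ : 0 < σ) (hS : S.PosDef) :
    (Vm σ S * (Vm σ S + (2 * σ) • S)⁻¹ * S).PosDef := by
  rw [← Matrix.posDef_inv_iff, inv_tilted_covariance hσ hS]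
  exact hS.inv.add ((posDef_Vm hσ hS).inv.smul (by positivity))

lemma det_rpow_tilted_covariance (hσ : 0 < σ) (hS : S.PosDef) :
    (Vm σ S).det ^ (-(1 : ℝ) / 2) * (S.det ^ (-(1 : ℝ) / 2) *
      (Vm σ S * (Vm σ S + (2 * σ) • S)⁻¹ * S).det ^ ((1 : ℝ) / 2)) =
      (Vm σ S + (2 * σ) • S).det ^ (-(1 : ℝ) / 2) := by
  have hS' := hS.det_pos
  have hV := (posDef_Vm hσ hS).det_pos
  have hW := (posDef_Vm_add hσ hS).det_pos
  have h {x : ℝ} (hx : 0 < x) : x ^ (-(1 : ℝ) / 2) * x ^ ((1 : ℝ) / 2) = 1 := by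
    rw [← Real.rpow_add hx]
    norm_num
  rw [det_mul, det_mul, det_nonsing_inv, Ring.inverse_eq_inv', Real.mul_rpow (by positivity) hS'.le,
    Real.mul_rpow hV.le (by positivity), Real.inv_rpow hW.le, ← Real.rpow_neg hW.le, neg_div 2 1]
  rw [neg_div] at h
  linear_combination (Vm σ S + (2 * σ) • S).det ^ (-((1 : ℝ) / 2)) *
    (S.det ^ (-((1 : ℝ) / 2)) * S.det ^ ((1 : ℝ) / 2) * h hV + h hS')

lemma integrable_and_integral_T2_self (hσ : 0 < σ) (hS : S.PosDef) :
    Integrable (fun x ↦ T2 σ m₀ S x x) (gaussN m₀ S) ∧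
      ∫ x, T2 σ m₀ S x x ∂gaussN m₀ S =
        (Vm σ S + (2 * σ) • S).det ^ (-(1 : ℝ) / 2) *
        (1 + 2 * σ * ((Vm σ S + (2 * σ) • S)⁻¹ * S).trace
           + 2 * σ ^ 2 * ((Vm σ S + (2 * σ) • S)⁻¹ * S).trace ^ 2
           + 4 * σ ^ 2 * (((Vm σ S + (2 * σ) • S)⁻¹ * S) ^ 2).trace) := by
  have hV := posDef_Vm hσ hS
  have hP := inv_tilted_covariance hσ hS
  have hS' := posDef_tilted_covariance hσ hS
  have hdet := det_rpow_tilted_covariance hσ hS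
  have hres := congrArg trace (inv_Vm_mul_sub hσ hS)
  have hVS : (Vm σ S)⁻¹ * (Vm σ S * (Vm σ S + (2 * σ) • S)⁻¹ * S) =
      (Vm σ S + (2 * σ) • S)⁻¹ * S := by
    rw [mul_assoc, nonsing_inv_mul_cancel_left _ _ hV.det_pos.ne'.isUnit]
  have hsym := transpose_inv_eq_of_posDef hV
  have hsym2 := transpose_inv_mul_mul_inv hS hV
  set W := Vm σ S + (2 * σ) • S
  set S' := Vm σ S * W⁻¹ * S
  have := isProbabilityMeasure_gaussN m₀ hS'
  have i1 := (integrable_quadratic_gaussN m₀ hS' hsym).const_mul σ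
  have i2 := (integrable_sq_quadratic_gaussN m₀ hS' hsym).const_mul (2 * σ ^ 2)
  have i3 := (integrable_quadratic_gaussN m₀ hS' hsym2).const_mul (2 * σ ^ 2)
  have i0 := integrable_const (μ := gaussN m₀ S') (1 + σ * ((Vm σ S)⁻¹ * S).trace)
  simp_rw [T2_self]
  refine ⟨(integrable_exp_quadratic_mul m₀ hS'.det_pos hP
    (((i0.add i1).add i2).sub i3)).const_mul _, ?_⟩
  rw [integral_const_mul, integral_exp_quadratic_mul m₀ hS.det_pos hS'.det_pos hP,
    ← mul_assoc, hdet, integral_sub ((i0.fun_add i1).fun_add i2) i3,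
    integral_add (i0.fun_add i1) i2, integral_add i0 i1, integral_const_mul, integral_const_mul,
    integral_const_mul, integral_quadratic_gaussN m₀ hS' hsym,
    integral_sq_quadratic_gaussN m₀ hS' hsym, integral_quadratic_gaussN m₀ hS' hsym2,
    mul_assoc ((Vm σ S)⁻¹ * S), hVS]
  rw [trace_sub, trace_smul, smul_eq_mul] at hres
  simp only [integral_const, probReal_univ, one_smul, sq (W⁻¹ * S)]
  linear_combination (W.det ^ (-(1 : ℝ) / 2) * σ) * hres

lemma integrable_and_integral_T4_self (hσ : 0 < σ) (hS : S.PosDef) :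
    Integrable (fun x ↦ T4 σ m₀ S x x) (gaussN m₀ S) ∧
      ∫ x, T4 σ m₀ S x x ∂gaussN m₀ S =
        (Vm σ S + (2 * σ) • S).det ^ (-(1 : ℝ) / 2) *
        (1 + 2 * σ * ((Vm σ S + (2 * σ) • S)⁻¹ * S).trace
           + 2 * σ ^ 2 * ((Vm σ S + (2 * σ) • S)⁻¹ * S).trace ^ 2
           + 4 * σ ^ 2 * (((Vm σ S + (2 * σ) • S)⁻¹ * S) ^ 2).trace) := by
  have hW := posDef_Vm_add hσ hS
  have hsym := transpose_inv_eq_of_posDef hW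
  have hsym2 := transpose_inv_mul_mul_inv hS hW
  simp_rw [T4_self, two_smul_Vm_sub_one]
  set W := Vm σ S + (2 * σ) • S
  have := isProbabilityMeasure_gaussN m₀ hS
  have i1 := (integrable_quadratic_gaussN m₀ hS hsym).const_mul (-(2 * σ ^ 2 * (W⁻¹ * S).trace))
  have i2 := (integrable_sq_quadratic_gaussN m₀ hS hsym).const_mul (3 * σ ^ 2)
  have i3 := (integrable_quadratic_gaussN m₀ hS hsym2).const_mul (4 * σ ^ 2)
  have i0 := integrable_const (μ := gaussN m₀ S) (1 + 2 * σ * (W⁻¹ * S).trace +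
    σ ^ 2 * (W⁻¹ * S).trace ^ 2 + 2 * σ ^ 2 * ((W⁻¹ * S) ^ 2).trace)
  refine ⟨(((i0.add i1).add i2).sub i3).const_mul _, ?_⟩
  rw [integral_const_mul, integral_sub ((i0.fun_add i1).fun_add i2) i3,
    integral_add (i0.fun_add i1) i2, integral_add i0 i1, integral_const_mul, integral_const_mul,
    integral_const_mul, integral_quadratic_gaussN m₀ hS hsym,
    integral_sq_quadratic_gaussN m₀ hS hsym, integral_quadratic_gaussN m₀ hS hsym2,
    mul_assoc (W⁻¹ * S)]
  simp only [integral_const, probReal_univ, one_smul, sq (W⁻¹ * S)]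
  ring

end Integrals

/-- Proposition 1: `∫ K(x,x) dN(m₀,Σ₀)(x) = 1 − det(2V − I_d)^{−1/2} ·
{ 1 + 2σ tr[(V+2σΣ₀)⁻¹Σ₀] + 2σ² (tr[(V+2σΣ₀)⁻¹Σ₀])² + 4σ² tr[((V+2σΣ₀)⁻¹Σ₀)²] }`. -/
theorem kernel_diagonal_integral {d : ℕ} (hd : 1 ≤ d) (σ : ℝ) (hσ : 0 < σ)
    (m₀ : Fin d → ℝ) (S : Matrix (Fin d) (Fin d) ℝ) (hS : S.PosDef) :
    ∫ x, Kf σ m₀ S x x ∂(gaussN m₀ S) =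
      1 - ((2 : ℝ) • Vm σ S - 1).det ^ (-(1 : ℝ) / 2) *
        (1 + 2 * σ * ((Vm σ S + (2 * σ) • S)⁻¹ * S).trace
           + 2 * σ ^ 2 * ((Vm σ S + (2 * σ) • S)⁻¹ * S).trace ^ 2
           + 4 * σ ^ 2 * (((Vm σ S + (2 * σ) • S)⁻¹ * S) ^ 2).trace) := by
  obtain ⟨i2, h2⟩ := integrable_and_integral_T2_self m₀ hσ hS
  obtain ⟨i4, h4⟩ := integrable_and_integral_T4_self m₀ hσ hS
  have := isProbabilityMeasure_gaussN m₀ hS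
  have i1 := integrable_const (μ := gaussN m₀ S) (1 : ℝ)
  simp_rw [Kf, T3, T1_self]
  rw [integral_add (f := fun x ↦ 1 - T2 σ m₀ S x x - T2 σ m₀ S x x) ((i1.sub i2).sub i2) i4,
    integral_sub (f := fun x ↦ 1 - T2 σ m₀ S x x) (i1.sub i2) i2,
    integral_sub i1 i2, h2, h4, two_smul_Vm_sub_one]
  simp only [integral_const, probReal_univ, one_smul]
  ring
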